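/- Let ε ∈ (0,1), p ∈ (2,∞), and let K_ε > 0 be such that sup_{t>0} t^{1/p} ‖e^{εtΔ}v‖_{Ḣ^{1/2+2/p}(ℝ³)} ≤ K_ε ‖v‖_{Ḣ^{1/2}(ℝ³)} for all v, and let c_ε = 1/(4C_ε) with C_ε the constant of the Navier–Stokes key lemma. Let u be a mild solution of the 3D incompressible Navier–Stokes equations on [t₀,∞) with u(t₀) ∈ H^{1/2}(ℝ³), u(t₀) ≠ 0, such that for every fixed λ > 0 the map T ↦ sup_{t₀<t≤t₀+T} (t−t₀)^{1/p} ‖F^{−1}(e^{−λ²(t−t₀)/(4(1−ε)T)+λ(t−t₀)|ξ|/√T}|û(t,ξ)|)‖_{Ḣ^{1/2+2/p}} is finite, continuous in T > 0, and tends to 0 as T → 0⁺. If ‖u(t₀)‖_{Ḣ^{1/2}} ≤ c_ε/(2K_ε), then for every T > 0, setting λ_T = 2√(1−ε) · log^{1/2}( c_ε / ( 2K_ε ‖u(t₀)‖_{Ḣ^{1/2}} ) ), one has T^{1/p} ‖F^{−1}( e^{λ_T √T |ξ|} |û(t₀+T,ξ)| )‖_{Ḣ^{1/2+2/p}} ≤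 c_ε; in particular R(t₀+T) ≥ 2√(1−ε) · T^{1/2} log^{1/2}( c_ε / ( 2K_ε ‖u(t₀)‖_{Ḣ^{1/2}} ) ) for every T > 0. -/

import Mathlib

open MeasureTheory Real Filter Topology
open scoped ENNReal NNReal

noncomputable section

/-- Euclidean space `ℝ^d`. -/
abbrev Rd (d : ℕ) := EuclideanSpace ℝ (Fin d)

/-- `ℂ^N` with the Euclidean norm. -/
abbrev CN (N : ℕ) := EuclideanSpace ℂ (Fin N)

/-- The homogeneous Sobolev norm `‖f‖_{Ḣ^s(ℝ^d)}` of a (vector-valued) function whose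
Fourier transform is `g`:  `(∫ |ξ|^{2s} |g(ξ)|² dξ)^{1/2}`, valued in `ℝ≥0∞`. -/
def hSob (d N : ℕ) (s : ℝ) (g : Rd d → CN N) : ℝ≥0∞ :=
  (∫⁻ ξ : Rd d, ENNReal.ofReal (‖ξ‖ ^ (2 * s) * ‖g ξ‖ ^ 2)) ^ (1/2 : ℝ)

/-- The same homogeneous Sobolev norm for a scalar nonnegative Fourier-side function. -/
def hSobR (d : ℕ) (s : ℝ) (g : Rd d → ℝ) : ℝ≥0∞ :=
  (∫⁻ ξ : Rd d, ENNReal.ofReal (‖ξ‖ ^ (2 * s) * g ξ ^ 2)) ^ (1/2 : ℝ)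

/-- The same homogeneous Sobolev norm for a scalar complex Fourier-side function. -/
def hSobC (d : ℕ) (s : ℝ) (g : Rd d → ℂ) : ℝ≥0∞ :=
  (∫⁻ ξ : Rd d, ENNReal.ofReal (‖ξ‖ ^ (2 * s) * ‖g ξ‖ ^ 2)) ^ (1/2 : ℝ)

/-- The Kato norm `‖U‖_{K^p_T} = sup_{0<t≤T} t^{1/p} ‖U(t)‖_{Ḣ^{s+2/p}}`,
for `U` given by its Fourier transform. -/
def kato (d N : ℕ) (s p T : ℝ) (U : ℝ → Rd d → CN N) : ℝ≥0∞ :=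
  ⨆ t ∈ Set.Ioc (0:ℝ) T, ENNReal.ofReal (t ^ (1/p)) * hSob d N (s + 2/p) (U t)

/-- The Kato norm for a scalar nonnegative Fourier-side function of time. -/
def katoR (d : ℕ) (s p T : ℝ) (g : ℝ → Rd d → ℝ) : ℝ≥0∞ :=
  ⨆ t ∈ Set.Ioc (0:ℝ) T, ENNReal.ofReal (t ^ (1/p)) * hSobR d (s + 2/p) (g t)

/-- Fourier multiplier of the heat flow `e^{aΔ}` applied to (the Fourier transform) `g`. -/
def heatHat (d N : ℕ) (a : ℝ) (g : Rd d → CN N) : Rd d → CN N :=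
  fun ξ => Real.exp (-(a * ‖ξ‖ ^ 2)) • g ξ

/-- The Kato norm `sup_{0<τ≤T} τ^{1/p} ‖e^{ντΔ}U₀‖_{Ḣ^{s+2/p}}` of the heat flow. -/
def heatKato (d N : ℕ) (ν s p T : ℝ) (g : Rd d → CN N) : ℝ≥0∞ :=
  ⨆ τ ∈ Set.Ioc (0:ℝ) T, ENNReal.ofReal (τ ^ (1/p)) * hSob d N (s + 2/p) (heatHat d N (ν * τ) g)

/-- The Gevrey-weighted modulus of the Fourier transform of `U`:
`Û_a(t,ξ) = e^{-λ²t/(4(1-ε)T) + λt|ξ|/√T} |Û(t,ξ)|`. -/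
def gevreyHat (d N : ℕ) (ε lam T : ℝ) (U : ℝ → Rd d → CN N) : ℝ → Rd d → ℝ :=
  fun t ξ =>
    Real.exp (-(lam ^ 2 * t) / (4 * (1 - ε) * T) + lam * t * ‖ξ‖ / Real.sqrt T) * ‖U t ξ‖

/-- `convIter d g n` is the `(n+1)`-fold convolution `g ⋆ ⋯ ⋆ g` of a nonnegative function. -/
def convIter (d : ℕ) (g : Rd d → ℝ≥0∞) : ℕ → Rd d → ℝ≥0∞
  | 0 => g
  | n + 1 => fun ξ => ∫⁻ η : Rd d, g η * convIter d g n (ξ - η)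

/-- The Fourier-side Duhamel inequality: for all `t ∈ (0,T]` and `ξ`,
`|Û(t,ξ)| ≤ e^{-t|ξ|²}|Û₀(ξ)| + C₀ ∫₀ᵗ e^{-(t-t')|ξ|²} |ξ|^β (|Û(t')|⋆⋯⋆|Û(t')|)(ξ) dt'`
(with a `k`-fold convolution). -/
def DuhamelIneq (d N k : ℕ) (β C₀ T : ℝ) (U₀ : Rd d → CN N) (U : ℝ → Rd d → CN N) : Prop :=
  ∀ t ∈ Set.Ioc (0:ℝ) T, ∀ ξ : Rd d,
    ENNReal.ofReal ‖U t ξ‖ ≤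
      ENNReal.ofReal (Real.exp (-(t * ‖ξ‖ ^ 2)) * ‖U₀ ξ‖) +
        ENNReal.ofReal C₀ *
          ∫⁻ t' in Set.Ioc (0:ℝ) t,
            ENNReal.ofReal (Real.exp (-((t - t') * ‖ξ‖ ^ 2)) * ‖ξ‖ ^ β) *
              convIter d (fun η => ENNReal.ofReal ‖U t' η‖) (k - 1) ξ

/-- Lower bound `R` for the radius of spatial analyticity of a function whose Fourier
transform is `g`: `R = sup{ρ ≥ 0 : ∫ e^{2ρ|ξ|} |ξ|^{2s} |g(ξ)|² dξ < ∞}`. -/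
def anaRadius (d N : ℕ) (s : ℝ) (g : Rd d → CN N) : ℝ≥0∞ :=
  ⨆ ρ ∈ {ρ : ℝ | 0 ≤ ρ ∧
      (∫⁻ ξ : Rd d, ENNReal.ofReal (Real.exp (2 * ρ * ‖ξ‖) * ‖ξ‖ ^ (2 * s) * ‖g ξ‖ ^ 2)) < ⊤},
    ENNReal.ofReal ρ

/-- The convolution of `n+1` complex-valued functions on `ℝ^d`. -/
def multiConvC (d n : ℕ) (g : Fin (n + 1) → Rd d → ℂ) (ξ : Rd d) : ℂ :=
  ∫ η : Fin n → Rd d, (∏ i : Fin n, g i.castSucc (η i)) * g (Fin.last n) (ξ - ∑ i, η i)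

/-- A symbol which is continuous away from `0` and homogeneous of degree `β`. -/
def SymbolHomog (d : ℕ) (β : ℝ) (a : Rd d → ℂ) : Prop :=
  ContinuousOn a {ξ : Rd d | ξ ≠ 0} ∧
    ∀ μ : ℝ, 0 < μ → ∀ ξ : Rd d, ξ ≠ 0 → a (μ • ξ) = ((μ ^ β : ℝ) : ℂ) * a ξ

/-- Fourier-side formulation of a mild solution of (SP) on `(0,T]`, with nonlinearity of
order `k = K+1` given by symbols `a j m` (indexed by the choice `m` of the component of `U`
appearing in each of the `k` factors, an equivalent parametrization of the multi-indices
`ℓ ∈ ℕ^N`, `|ℓ| = k`):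
`Û_j(t,ξ) = e^{-t|ξ|²} Û₀_j(ξ) + ∫₀ᵗ e^{-(t-t')|ξ|²} Σ_m a_{j,m}(ξ) (2π)^{-dK} (Û_{m 0} ⋆ ⋯ ⋆ Û_{m K})(ξ) dt'`. -/
def IsMildSolSP (d N K : ℕ) (T : ℝ) (a : Fin N → (Fin (K + 1) → Fin N) → Rd d → ℂ)
    (U₀ : Rd d → CN N) (U : ℝ → Rd d → CN N) : Prop :=
  ∀ t ∈ Set.Ioc (0:ℝ) T, ∀ ξ : Rd d, ∀ j : Fin N,
    U t ξ j = (Real.exp (-(t * ‖ξ‖ ^ 2)) : ℂ) * U₀ ξ j +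
      (((2 * Real.pi) ^ (d * K) : ℝ) : ℂ)⁻¹ *
        ∫ t' in Set.Ioc (0:ℝ) t,
          (Real.exp (-((t - t') * ‖ξ‖ ^ 2)) : ℂ) *
            ∑ m : Fin (K + 1) → Fin N, a j m ξ * multiConvC d K (fun i η => U t' η (m i)) ξ


/-- Convolution of two complex-valued functions on `ℝ³`. -/
def conv2C (f g : Rd 3 → ℂ) (ξ : Rd 3) : ℂ :=
  ∫ η : Rd 3, f η * g (ξ - η)

/-- Convolution of two nonnegative (extended-real-valued) functions on `ℝ³`. -/
def conv2E (f g : Rd 3 → ℝ≥0∞) (ξ : Rd 3) : ℝ≥0∞ :=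
  ∫⁻ η : Rd 3, f η * g (ξ - η)

/-- Fourier-side formulation of a mild solution of the 3D incompressible Navier–Stokes
equations on `[t₀,∞)`: for `t > t₀` and `ξ ≠ 0`,
`û_j(t,ξ) = e^{−(t−t₀)|ξ|²} û_j(t₀,ξ) − (2π)^{-3} ∫_{t₀}^t e^{−(t−t')|ξ|²} i
Σ_{l,m} (δ_{jl} − ξ_jξ_l/|ξ|²) ξ_m (û_l ⋆ û_m)(t',ξ) dt'`
(Fourier transform of `u(t) = e^{(t−t₀)Δ}u(t₀) − ∫_{t₀}^t e^{(t−t')Δ} ℙ div(u⊗u)(t')dt'`,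
where `ℙ = Id − ∇Δ⁻¹div` is the Leray projector). -/
def IsNSMildFourier (t₀ : ℝ) (u : ℝ → Rd 3 → CN 3) : Prop :=
  ∀ t : ℝ, t₀ < t → ∀ ξ : Rd 3, ξ ≠ 0 → ∀ j : Fin 3,
    u t ξ j = (Real.exp (-((t - t₀) * ‖ξ‖ ^ 2)) : ℂ) * u t₀ ξ j -
      (((2 * Real.pi) ^ (3:ℕ) : ℝ) : ℂ)⁻¹ *
        ∫ t' in Set.Ioc t₀ t,
          (Real.exp (-((t - t') * ‖ξ‖ ^ 2)) : ℂ) * Complex.I *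
            ∑ l : Fin 3, ∑ m : Fin 3,
              ((((if j = l then (1:ℝ) else 0) - ξ j * ξ l / ‖ξ‖ ^ 2 : ℝ)) : ℂ) *
                ((ξ m : ℝ) : ℂ) *
                conv2C (fun η => u t' η l) (fun η => u t' η m) ξ

/-- The Fourier-side Duhamel inequality satisfied by mild solutions of the 3D
Navier–Stokes equations, from initial time `t₀`, on `(t₀, t₀+T]`:
`|û(t,ξ)| ≤ e^{−(t−t₀)|ξ|²}|û(t₀,ξ)| + C₀ ∫_{t₀}^t e^{−(t−t')|ξ|²}|ξ| (|û(t')|⋆|û(t')|)(ξ) dt'`. -/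
def NSDuhamelIneq (C₀ t₀ T : ℝ) (u : ℝ → Rd 3 → CN 3) : Prop :=
  ∀ t ∈ Set.Ioc t₀ (t₀ + T), ∀ ξ : Rd 3,
    ENNReal.ofReal ‖u t ξ‖ ≤
      ENNReal.ofReal (Real.exp (-((t - t₀) * ‖ξ‖ ^ 2)) * ‖u t₀ ξ‖) +
        ENNReal.ofReal C₀ *
          ∫⁻ t' in Set.Ioc t₀ t,
            ENNReal.ofReal (Real.exp (-((t - t') * ‖ξ‖ ^ 2)) * ‖ξ‖) *
              conv2E (fun η => ENNReal.ofReal ‖u t' η‖)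
                (fun η => ENNReal.ofReal ‖u t' η‖) ξ

/-- The Gevrey-weighted modulus `û_{a,t₀}(t,ξ)` with initial time `t₀`:
`e^{−λ²(t−t₀)/(4(1−ε)T) + λ(t−t₀)|ξ|/√T} |û(t,ξ)|`. -/
def NSgevrey (ε lam T t₀ : ℝ) (u : ℝ → Rd 3 → CN 3) : ℝ → Rd 3 → ℝ :=
  fun t ξ =>
    Real.exp (-(lam ^ 2 * (t - t₀)) / (4 * (1 - ε) * T) + lam * (t - t₀) * ‖ξ‖ / Real.sqrt T)
      * ‖u t ξ‖

/-- Shifted Kato norm `‖v‖_{K^p_{t₀,T}} = sup_{t₀<t≤t₀+T} (t−t₀)^{1/p} ‖v(t)‖_{Ḣ^{1/2+2/p}}`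
for a scalar nonnegative Fourier-side function of time. -/
def NSkatoR (p t₀ T : ℝ) (g : ℝ → Rd 3 → ℝ) : ℝ≥0∞ :=
  ⨆ t ∈ Set.Ioc t₀ (t₀ + T), ENNReal.ofReal ((t - t₀) ^ (1 / p)) * hSobR 3 (1/2 + 2 / p) (g t)

/-- Shifted Kato norm for a vector-valued Fourier-side function of time. -/
def NSkatoC (p t₀ T : ℝ) (U : ℝ → Rd 3 → CN 3) : ℝ≥0∞ :=
  ⨆ t ∈ Set.Ioc t₀ (t₀ + T), ENNReal.ofReal ((t - t₀) ^ (1 / p)) * hSob 3 3 (1/2 + 2 / p) (U t)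

/-- The inhomogeneous `H^{1/2}(ℝ³)` norm, on the Fourier side. -/
def hInhomHalf (g : Rd 3 → CN 3) : ℝ≥0∞ :=
  (∫⁻ ξ : Rd 3, ENNReal.ofReal ((1 + ‖ξ‖ ^ 2) ^ ((1:ℝ)/2) * ‖g ξ‖ ^ 2)) ^ (1/2 : ℝ)

lemma aux_cs {α : Type*} [MeasurableSpace α] (μ : Measure α) {f g : α → ℝ≥0∞}
    (hf : AEMeasurable f μ) (hg : AEMeasurable g μ) :
    (∫⁻ a, f a * g a ∂μ) ^ 2 ≤ (∫⁻ a, f a ^ 2 ∂μ) * (∫⁻ a, g a ^ 2 ∂μ) := by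
  have h := ENNReal.lintegral_mul_le_Lp_mul_Lq μ Real.HolderConjugate.two_two hf hg
  simp only [Pi.mul_apply, ENNReal.rpow_two] at h
  have h2 := pow_le_pow_left' h 2
  refine h2.trans (le_of_eq ?_)
  rw [mul_pow, ← ENNReal.rpow_two, ← ENNReal.rpow_two, ← ENNReal.rpow_mul, ← ENNReal.rpow_mul]
  norm_num

lemma aux_sq_add (a b : ℝ≥0∞) : (a + b) ^ 2 ≤ 2 * a ^ 2 + 2 * b ^ 2 := by
  have h := ENNReal.rpow_add_le_mul_rpow_add_rpow a b (p := 2) (by norm_num)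
  simp only [ENNReal.rpow_two] at h
  norm_num at h
  rw [mul_add] at h
  exact h

def auxR (s : ℝ) (x : Rd 3) : ℝ≥0∞ := ENNReal.ofReal (if ‖x‖ < 2 then ‖x‖ ^ (-s) else 0)

lemma auxR_meas (s : ℝ) : Measurable (auxR s) := by
  unfold auxR
  refine ENNReal.measurable_ofReal.comp (Measurable.ite ?_ ?_ measurable_const)
  · exact measurableSet_lt measurable_norm measurable_const
  · exact measurable_norm.pow_const _

lemma auxR_int (s : ℝ) (hs : s < 3 / 2) : ∫⁻ x, auxR s x ^ 2 < ⊤ := by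
  have h1 : IntegrableOn (fun x : Rd 3 => ‖x‖ ^ (-(2 * s))) (Metric.ball 0 2) := by
    rw [integrableOn_fun_norm_addHaar volume (f := fun y => y ^ (-(2 * s)))]
    have h2 : IntegrableOn (fun y : ℝ => y ^ (2 - 2 * s)) (Set.Ioo 0 2) := by
      rw [intervalIntegral.integrableOn_Ioo_rpow_iff (by norm_num)]
      linarith
    refine h2.congr_fun (fun y hy => ?_) measurableSet_Ioo
    have : Module.finrank ℝ (Rd 3) = 3 := by simp
    simp only [this, smul_eq_mul]
    rw [sub_eq_add_neg, Real.rpow_add hy.1]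
    norm_num
  have h3 := h1.lintegral_lt_top
  refine lt_of_le_of_lt ?_ h3
  rw [← lintegral_indicator measurableSet_ball]
  refine lintegral_mono fun x => ?_
  unfold auxR
  by_cases hx : ‖x‖ < 2
  · rw [Set.indicator_of_mem (by simpa using hx), if_pos hx, ← ENNReal.ofReal_pow (by positivity),
      ← Real.rpow_natCast, ← Real.rpow_mul (norm_nonneg _)]
    apply le_of_eq; congr 2; push_cast; ring
  · simp [hx]

lemma aux_real (s a b x : ℝ) (hs : 0 < s) (ha : 0 < a) (hb : 0 < b) (hx : 0 < x) (hx1 : x ≤ 1)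
    (hxab : x ≤ a + b) (h1 : a ≤ x + b) (h2 : b ≤ x + a) :
    1 ≤ a ^ s * b ^ s * (1 + (x / 2) ^ (-s) * ((if a < 2 then a ^ (-s) else 0) +
      (if b < 2 then b ^ (-s) else 0))) := by
  have key : ∀ a b : ℝ, 0 < a → 0 < b → x ≤ a + b → a ≤ x + b → b ≤ x + a → a ≤ b →
      1 ≤ a ^ s * b ^ s * (1 + (x / 2) ^ (-s) * ((if a < 2 then a ^ (-s) else 0) +
      (if b < 2 then b ^ (-s) else 0))) := by
    intro a b ha hb hxab h1 h2 hab
    have hB : 0 ≤ (if b < 2 then b ^ (-s) else 0) := by split_ifs <;> positivity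
    have hA : 0 ≤ (if a < 2 then a ^ (-s) else 0) := by split_ifs <;> positivity
    have hx' : 0 < (x / 2) ^ (-s) := by positivity
    by_cases h : 1 ≤ a
    · have e1 : 1 ≤ a ^ s := Real.one_le_rpow h hs.le
      have e2 : 1 ≤ b ^ s := Real.one_le_rpow (h.trans hab) hs.le
      have e3 : 1 ≤ a ^ s * b ^ s := one_le_mul_of_one_le_of_one_le e1 e2
      refine one_le_mul_of_one_le_of_one_le e3 ?_
      have := mul_nonneg hx'.le (add_nonneg hA hB)
      linarith
    · push Not at h
      have e : (x / 2) ^ s ≤ b ^ s := Real.rpow_le_rpow (by positivity) (by linarith) hs.le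
      have ex : (x / 2) ^ s * (x / 2) ^ (-s) = 1 := by
        rw [← Real.rpow_add (by positivity)]; simp
      have ea : a ^ s * a ^ (-s) = 1 := by
        rw [← Real.rpow_add (by positivity)]; simp
      calc (1:ℝ) = (x / 2) ^ s * (x / 2) ^ (-s) * (a ^ s * a ^ (-s)) := by rw [ex, ea]; norm_num
        _ ≤ b ^ s * (x / 2) ^ (-s) * (a ^ s * a ^ (-s)) := by gcongr
        _ = a ^ s * b ^ s * ((x / 2) ^ (-s) * a ^ (-s)) := by ring
        _ ≤ _ := by
          rw [if_pos (by linarith : a < 2)]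
          have : 0 ≤ (x / 2) ^ (-s) * (if b < 2 then b ^ (-s) else 0) := mul_nonneg hx'.le hB
          gcongr
          linarith
  rcases le_total a b with h | h
  · exact key a b ha hb hxab h1 h2 h
  · have := key b a hb ha (by linarith) h2 h1 h
    convert this using 1
    ring

def auxW (s : ℝ) (f : Rd 3 → ℝ≥0∞) (x : Rd 3) : ℝ≥0∞ := ENNReal.ofReal (‖x‖ ^ s) * f x

lemma auxW_meas (s : ℝ) {f : Rd 3 → ℝ≥0∞} (hf : Measurable f) : Measurable (auxW s f) :=
  (ENNReal.measurable_ofReal.comp (measurable_norm.pow_const _)).mul hf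

lemma aux_conv_le (s : ℝ) (hs : 0 < s) {f : Rd 3 → ℝ≥0∞} (hf : Measurable f) (ξ : Rd 3)
    (h0 : ξ ≠ 0) (h1 : ‖ξ‖ ≤ 1) :
    conv2E f f ξ ^ 2 ≤ 2 * (∫⁻ x, auxW s f x ^ 2) ^ 2 +
      ENNReal.ofReal (‖ξ‖ ^ (-(2 * s))) * ((ENNReal.ofReal (2 ^ (2 * s)) * 8 *
        ∫⁻ x, auxR s x ^ 2) *
        conv2E (fun x => auxW s f x ^ 2) (fun x => auxW s f x ^ 2) ξ) := by
  have hw := auxW_meas s hf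
  have hr := auxR_meas s
  have hsub : Measurable fun η : Rd 3 => ξ - η := measurable_const.sub measurable_id
  set w := auxW s f with hwdef
  have hww : Measurable fun η : Rd 3 => w η * w (ξ - η) := hw.mul (hw.comp hsub)
  have hrs : Measurable fun η : Rd 3 => auxR s (ξ - η) := hr.comp hsub
  have hrr : Measurable fun η : Rd 3 => auxR s η + auxR s (ξ - η) := hr.add hrs
  have hws : Measurable fun η : Rd 3 => w (ξ - η) := hw.comp hsub
  set κ := ENNReal.ofReal ((‖ξ‖ / 2) ^ (-s)) with hκ
  have hx : 0 < ‖ξ‖ := norm_pos_iff.mpr h0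
  -- pointwise
  have hpt : ∀ᵐ η : Rd 3, f η * f (ξ - η) ≤ w η * w (ξ - η) +
      κ * (w η * w (ξ - η) * (auxR s η + auxR s (ξ - η))) := by
    have e1 : ∀ᵐ η : Rd 3, η ≠ 0 := by
      simp [ae_iff]
    have e2 : ∀ᵐ η : Rd 3, η ≠ ξ := by
      simp [ae_iff]
    filter_upwards [e1, e2] with η hη0 hηξ
    have ha : 0 < ‖η‖ := norm_pos_iff.mpr hη0
    have hb : 0 < ‖ξ - η‖ := norm_pos_iff.mpr (sub_ne_zero.mpr hηξ.symm)
    have t1 : ‖ξ‖ ≤ ‖η‖ + ‖ξ - η‖ := by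
      calc ‖ξ‖ = ‖η + (ξ - η)‖ := by congr 1; abel
        _ ≤ _ := norm_add_le _ _
    have t2 : ‖η‖ ≤ ‖ξ‖ + ‖ξ - η‖ := by
      calc ‖η‖ = ‖ξ - (ξ - η)‖ := by congr 1; abel
        _ ≤ _ := norm_sub_le _ _
    have t3 : ‖ξ - η‖ ≤ ‖ξ‖ + ‖η‖ := norm_sub_le _ _
    have hr := aux_real s ‖η‖ ‖ξ - η‖ ‖ξ‖ hs ha hb hx h1 t1 t2 t3
    have hB : 0 ≤ (if ‖ξ - η‖ < 2 then ‖ξ - η‖ ^ (-s) else 0) := by split_ifs <;> positivity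
    have hA : 0 ≤ (if ‖η‖ < 2 then ‖η‖ ^ (-s) else 0) := by split_ifs <;> positivity
    have hx' : 0 < (‖ξ‖ / 2) ^ (-s) := by positivity
    have hr' := ENNReal.ofReal_le_ofReal hr
    rw [ENNReal.ofReal_one, ENNReal.ofReal_mul (by positivity), ENNReal.ofReal_mul (by positivity),
      ENNReal.ofReal_add (by norm_num) (by positivity), ENNReal.ofReal_mul (by positivity),
      ENNReal.ofReal_add hA hB, ENNReal.ofReal_one] at hr'
    calc f η * f (ξ - η) = f η * f (ξ - η) * 1 := by rw [mul_one]
      _ ≤ _ := mul_le_mul_right hr' _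
      _ = _ := by
        simp only [hwdef, auxW, auxR, hκ]; ring
  have hI : conv2E f f ξ ≤ (∫⁻ η, w η * w (ξ - η)) +
      κ * ∫⁻ η, w η * w (ξ - η) * (auxR s η + auxR s (ξ - η)) := by
    unfold conv2E
    refine (lintegral_mono_ae hpt).trans (le_of_eq ?_)
    rw [lintegral_add_left hww, lintegral_const_mul κ (f := fun η => w η * w (ξ - η) * (auxR s η + auxR s (ξ - η))) (hww.mul hrr)]
  have hA : (∫⁻ η, w η * w (ξ - η)) ^ 2 ≤ (∫⁻ x, w x ^ 2) ^ 2 := by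
    refine (aux_cs volume hw.aemeasurable hws.aemeasurable).trans (le_of_eq ?_)
    rw [sq (∫⁻ x, w x ^ 2)]
    congr 1
    exact lintegral_sub_left_eq_self (fun x => w x ^ 2) ξ
  have hB : (∫⁻ η, w η * w (ξ - η) * (auxR s η + auxR s (ξ - η))) ^ 2 ≤
      conv2E (fun x => w x ^ 2) (fun x => w x ^ 2) ξ * (4 * ∫⁻ x, auxR s x ^ 2) := by
    refine (aux_cs volume hww.aemeasurable hrr.aemeasurable).trans ?_
    unfold conv2E
    simp only [mul_pow]
    gcongr
    refine (lintegral_mono fun η => aux_sq_add _ _).trans (le_of_eq ?_)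
    rw [lintegral_add_left ((hr.pow_const 2).const_mul 2), lintegral_const_mul _ (hr.pow_const 2),
      lintegral_const_mul _ (hrs.pow_const 2),
      lintegral_sub_left_eq_self (fun x => auxR s x ^ 2) ξ, ← add_mul]
    norm_num
  have hκ2 : κ ^ 2 = ENNReal.ofReal (‖ξ‖ ^ (-(2 * s))) * ENNReal.ofReal (2 ^ (2 * s)) := by
    rw [hκ, ← ENNReal.ofReal_pow (by positivity), ← ENNReal.ofReal_mul (by positivity)]
    congr 1
    rw [← Real.rpow_natCast, ← Real.rpow_mul (by positivity), Real.div_rpow (by positivity) (by norm_num)]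
    have : -s * ((2:ℕ):ℝ) = -(2 * s) := by push_cast; ring
    rw [this, Real.rpow_neg (by norm_num : (0:ℝ) ≤ 2)]
    field_simp
  calc conv2E f f ξ ^ 2 ≤ _ := pow_le_pow_left' hI 2
    _ ≤ _ := aux_sq_add _ _
    _ ≤ 2 * (∫⁻ x, w x ^ 2) ^ 2 + 2 * (κ ^ 2 * (conv2E (fun x => w x ^ 2) (fun x => w x ^ 2) ξ * (4 * ∫⁻ x, auxR s x ^ 2))) := by
      rw [mul_pow κ]
      gcongr
    _ = _ := by
      rw [hκ2]; ring

lemma aux_conv_int {g : Rd 3 → ℝ≥0∞} (hg : Measurable g) :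
    ∫⁻ ξ, conv2E g g ξ = (∫⁻ x, g x) ^ 2 := by
  unfold conv2E
  rw [lintegral_lintegral_swap]
  · have : ∀ η : Rd 3, ∫⁻ ξ, g η * g (ξ - η) = g η * ∫⁻ x, g x := by
      intro η
      have hm : Measurable fun ξ : Rd 3 => g (ξ - η) := hg.comp (measurable_id.sub measurable_const)
      rw [lintegral_const_mul _ hm]
      congr 1
      exact lintegral_sub_right_eq_self g η
    simp only [this]
    rw [lintegral_mul_const _ hg, sq]
  · exact ((hg.comp measurable_snd).mul (hg.comp (measurable_fst.sub measurable_snd))).aemeasurable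

lemma aux_spatial (s : ℝ) (hs : 0 < s) (hs3 : s < 3 / 2) :
    ∃ K : ℝ≥0∞, K < ⊤ ∧ ∀ f : Rd 3 → ℝ≥0∞, Measurable f →
      ∫⁻ ξ in Metric.closedBall (0 : Rd 3) 1, ENNReal.ofReal (‖ξ‖ ^ 3) * conv2E f f ξ ^ 2 ≤
        K * (∫⁻ x, auxW s f x ^ 2) ^ 2 := by
  set K1 := ENNReal.ofReal (2 ^ (2 * s)) * 8 * ∫⁻ x, auxR s x ^ 2 with hK1
  refine ⟨2 * volume (Metric.closedBall (0 : Rd 3) 1) + K1, ?_, ?_⟩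
  · refine ENNReal.add_lt_top.mpr ⟨ENNReal.mul_lt_top (by simp) ?_, ?_⟩
    · exact measure_closedBall_lt_top
    · exact ENNReal.mul_lt_top (ENNReal.mul_lt_top (by simp) (by norm_num)) (auxR_int s hs3)
  · intro f hf
    set W := ∫⁻ x, auxW s f x ^ 2 with hW
    have hw2 : Measurable (fun x => auxW s f x ^ 2) := (auxW_meas s hf).pow_const 2
    have hcm : Measurable (conv2E (fun x => auxW s f x ^ 2) (fun x => auxW s f x ^ 2)) := by
      unfold conv2E
      exact Measurable.lintegral_prod_right
        ((hw2.comp measurable_snd).mul (hw2.comp (measurable_fst.sub measurable_snd)))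
    have hpt : ∀ ξ ∈ Metric.closedBall (0 : Rd 3) 1,
        ENNReal.ofReal (‖ξ‖ ^ 3) * conv2E f f ξ ^ 2 ≤ 2 * W ^ 2 +
          K1 * conv2E (fun x => auxW s f x ^ 2) (fun x => auxW s f x ^ 2) ξ := by
      intro ξ hξ
      have h1 : ‖ξ‖ ≤ 1 := by simpa using hξ
      rcases eq_or_ne ξ 0 with rfl | h0
      · simp
      have hx : 0 < ‖ξ‖ := norm_pos_iff.mpr h0
      have e1 : ENNReal.ofReal (‖ξ‖ ^ 3) ≤ 1 := by
        rw [← ENNReal.ofReal_one]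
        exact ENNReal.ofReal_le_ofReal (pow_le_one₀ hx.le h1)
      have e2 : ENNReal.ofReal (‖ξ‖ ^ 3) * ENNReal.ofReal (‖ξ‖ ^ (-(2 * s))) ≤ 1 := by
        rw [← ENNReal.ofReal_mul (by positivity), ← ENNReal.ofReal_one]
        refine ENNReal.ofReal_le_ofReal ?_
        rw [← Real.rpow_natCast, ← Real.rpow_add hx]
        exact Real.rpow_le_one hx.le h1 (by push_cast; linarith)
      refine (mul_le_mul_right (aux_conv_le s hs hf ξ h0 h1) _).trans ?_
      rw [mul_add, ← mul_assoc (ENNReal.ofReal (‖ξ‖ ^ 3)) (ENNReal.ofReal _)]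
      refine add_le_add ?_ ?_
      · exact mul_le_of_le_one_left zero_le e1
      · exact mul_le_of_le_one_left zero_le e2
    refine (setLIntegral_mono' measurableSet_closedBall hpt).trans ?_
    rw [lintegral_add_left measurable_const, setLIntegral_const, add_mul]
    refine add_le_add (le_of_eq (by ring)) ?_
    refine (setLIntegral_le_lintegral _ _).trans ?_
    rw [lintegral_const_mul _ hcm, aux_conv_int hw2]

lemma aux_low (s p t₀ T : ℝ) (hs : 0 < s) (hs3 : s < 3 / 2) (hp : 2 < p) (hT : 0 < T)
    (F : ℝ → Rd 3 → ℝ≥0∞) (hF : Measurable fun q : ℝ × Rd 3 => F q.1 q.2) (M : ℝ≥0∞)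
    (hM : M < ⊤)
    (hb : ∀ t ∈ Set.Ioc t₀ (t₀ + T),
      ∫⁻ x, auxW s (F t) x ^ 2 ≤ M * ENNReal.ofReal ((t - t₀) ^ (-(2 / p)))) :
    ∫⁻ ξ in Metric.closedBall (0 : Rd 3) 1, ENNReal.ofReal (‖ξ‖ ^ 3) *
      (∫⁻ t in Set.Ioc t₀ (t₀ + T), conv2E (F t) (F t) ξ) ^ 2 < ⊤ := by
  obtain ⟨K, hK, hKb⟩ := aux_spatial s hs hs3
  set I := Set.Ioc t₀ (t₀ + T) with hI
  have hFt : ∀ t, Measurable (F t) := fun t => hF.comp (measurable_const.prodMk measurable_id)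
  set g : ℝ → ℝ≥0∞ := fun t => ENNReal.ofReal ((t - t₀) ^ (1 / p)) with hg
  set g' : ℝ → ℝ≥0∞ := fun t => ENNReal.ofReal ((t - t₀) ^ (-(1 / p))) with hg'
  have hgm : Measurable g := by
    refine ENNReal.measurable_ofReal.comp (Measurable.pow_const ?_ _)
    fun_prop
  have hgm' : Measurable g' := by
    refine ENNReal.measurable_ofReal.comp (Measurable.pow_const ?_ _)
    fun_prop
  have hgg : ∀ t ∈ I, g' t * g t = 1 := by
    intro t ht
    have : 0 < t - t₀ := sub_pos.mpr ht.1
    simp only [hg, hg']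
    rw [← ENNReal.ofReal_mul (by positivity), ← Real.rpow_add this]
    simp
  have hg2 : ∀ t ∈ I, ENNReal.ofReal ((t - t₀) ^ (-(2 / p))) = g' t ^ 2 := by
    intro t ht
    have : 0 < t - t₀ := sub_pos.mpr ht.1
    simp only [hg']
    rw [← ENNReal.ofReal_pow (by positivity), ← Real.rpow_natCast, ← Real.rpow_mul this.le]
    congr 2
    push_cast; ring
  have hQ : ∫⁻ t in I, g' t ^ 2 < ⊤ := by
    have h1 : IntervalIntegrable (fun x : ℝ => x ^ (-(2 / p))) volume 0 T := by
      apply intervalIntegral.intervalIntegrable_rpow'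
      have : 2 / p < 1 := by rw [div_lt_one (by linarith)]; exact hp
      linarith
    have h2 := h1.comp_sub_right t₀
    rw [zero_add, intervalIntegrable_iff_integrableOn_Ioc_of_le (by linarith), add_comm T] at h2
    have h3 := h2.lintegral_lt_top
    rwa [setLIntegral_congr_fun measurableSet_Ioc hg2] at h3
  set Q := ∫⁻ t in I, g' t ^ 2 with hQd
  have hcm : Measurable fun q : ℝ × Rd 3 => conv2E (F q.1) (F q.1) q.2 := by
    unfold conv2E
    refine Measurable.lintegral_prod_right (f := fun (q : ℝ × Rd 3) (η : Rd 3) =>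
      F q.1 η * F q.1 (q.2 - η)) ?_
    refine Measurable.mul ?_ ?_
    · exact hF.comp ((measurable_fst.comp measurable_fst).prodMk measurable_snd)
    · exact hF.comp ((measurable_fst.comp measurable_fst).prodMk
        ((measurable_snd.comp measurable_fst).sub measurable_snd))
  have hcs : ∀ ξ, (∫⁻ t in I, conv2E (F t) (F t) ξ) ^ 2 ≤
      Q * ∫⁻ t in I, (g t * conv2E (F t) (F t) ξ) ^ 2 := by
    intro ξ
    have hm : Measurable fun t => conv2E (F t) (F t) ξ :=
      hcm.comp (measurable_id.prodMk measurable_const)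
    have e : ∫⁻ t in I, conv2E (F t) (F t) ξ =
        ∫⁻ t in I, g' t * (g t * conv2E (F t) (F t) ξ) := by
      refine setLIntegral_congr_fun measurableSet_Ioc fun t ht => ?_
      rw [← mul_assoc, hgg t ht, one_mul]
    rw [e]
    exact aux_cs _ hgm'.aemeasurable (hgm.mul hm).aemeasurable
  have hn : Measurable fun ξ : Rd 3 => ENNReal.ofReal (‖ξ‖ ^ 3) := by fun_prop
  have hgc : Measurable fun q : Rd 3 × ℝ => g q.2 * conv2E (F q.2) (F q.2) q.1 :=
    (hgm.comp measurable_snd).mul (hcm.comp measurable_swap)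
  calc ∫⁻ ξ in Metric.closedBall (0 : Rd 3) 1, ENNReal.ofReal (‖ξ‖ ^ 3) *
      (∫⁻ t in I, conv2E (F t) (F t) ξ) ^ 2
      ≤ ∫⁻ ξ in Metric.closedBall (0 : Rd 3) 1, Q *
          ∫⁻ t in I, ENNReal.ofReal (‖ξ‖ ^ 3) * (g t * conv2E (F t) (F t) ξ) ^ 2 := by
        refine lintegral_mono fun ξ => ?_
        rw [lintegral_const_mul' _ _ (by simp)]
        refine (mul_le_mul_right (hcs ξ) _).trans (le_of_eq ?_)
        ring
    _ = Q * ∫⁻ ξ in Metric.closedBall (0 : Rd 3) 1,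
          ∫⁻ t in I, ENNReal.ofReal (‖ξ‖ ^ 3) * (g t * conv2E (F t) (F t) ξ) ^ 2 := by
        rw [lintegral_const_mul' _ _ hQ.ne]
    _ = Q * ∫⁻ t in I, ∫⁻ ξ in Metric.closedBall (0 : Rd 3) 1,
          ENNReal.ofReal (‖ξ‖ ^ 3) * (g t * conv2E (F t) (F t) ξ) ^ 2 := by
        rw [lintegral_lintegral_swap]
        exact ((hn.comp measurable_fst).mul (hgc.pow_const 2)).aemeasurable
    _ ≤ Q * ∫⁻ t in I, K * M ^ 2 * g' t ^ 2 := by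
        gcongr 1
        refine setLIntegral_mono' measurableSet_Ioc fun t ht => ?_
        have e : ∀ ξ : Rd 3, ENNReal.ofReal (‖ξ‖ ^ 3) * (g t * conv2E (F t) (F t) ξ) ^ 2 =
          g t ^ 2 * (ENNReal.ofReal (‖ξ‖ ^ 3) * conv2E (F t) (F t) ξ ^ 2) := by
          intro ξ; ring
        simp only [e]
        rw [lintegral_const_mul' _ _ (by simp [hg])]
        have h1 := hb t ht
        rw [hg2 t ht] at h1
        calc g t ^ 2 * _ ≤ g t ^ 2 * (K * (M * g' t ^ 2) ^ 2) := by
              refine mul_le_mul_right ((hKb (F t) (hFt t)).trans ?_) _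
              gcongr
          _ = K * M ^ 2 * g' t ^ 2 * (g' t * g t) ^ 2 := by ring
          _ = _ := by rw [hgg t ht]; ring
    _ < ⊤ := by
        rw [lintegral_const_mul _ (hgm'.pow_const 2)]
        exact ENNReal.mul_lt_top hQ (ENNReal.mul_lt_top (ENNReal.mul_lt_top hK
          (ENNReal.pow_lt_top hM)) hQ)

lemma aux_hSobR_mul (s a : ℝ) (ha : 0 ≤ a) (g : Rd 3 → ℝ) :
    hSobR 3 s (fun ξ => a * g ξ) = ENNReal.ofReal a * hSobR 3 s g := by
  unfold hSobR
  have : ∀ ξ : Rd 3, ENNReal.ofReal (‖ξ‖ ^ (2 * s) * (a * g ξ) ^ 2) =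
      ENNReal.ofReal (a ^ 2) * ENNReal.ofReal (‖ξ‖ ^ (2 * s) * g ξ ^ 2) := by
    intro ξ
    rw [← ENNReal.ofReal_mul (by positivity)]
    congr 1; ring
  simp only [this]
  rw [lintegral_const_mul' _ _ (by simp), ENNReal.mul_rpow_of_nonneg _ _ (by norm_num)]
  congr 1
  rw [ENNReal.ofReal_rpow_of_nonneg (by positivity) (by norm_num), ← Real.sqrt_eq_rpow,
    Real.sqrt_sq ha]

lemma aux_hSobR_mono (s : ℝ) (g h : Rd 3 → ℝ) (h0 : ∀ ξ, 0 ≤ g ξ) (hgh : ∀ ξ, g ξ ≤ h ξ) :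
    hSobR 3 s g ≤ hSobR 3 s h := by
  unfold hSobR
  gcongr
  · exact h0 _
  · exact hgh _

lemma aux_first (ε p C₀ Kε Cε : ℝ) (hε : ε ∈ Set.Ioo (0:ℝ) 1)
    (hKε : 0 < Kε) (hCε : 0 < Cε)
    (hKprop : ∀ v : Rd 3 → CN 3, ∀ t : ℝ, 0 < t →
      ENNReal.ofReal (t ^ (1 / p)) * hSob 3 3 (1/2 + 2 / p) (heatHat 3 3 (ε * t) v) ≤
        ENNReal.ofReal Kε * hSob 3 3 (1/2) v)
    (hkey : ∀ lam T s₀ : ℝ, 0 < lam → 0 < T → 0 ≤ s₀ →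
      ∀ v : ℝ → Rd 3 → CN 3,
        (∀ j : Fin 3, Measurable fun q : ℝ × Rd 3 => v q.1 q.2 j) →
        NSDuhamelIneq C₀ s₀ T v →
        NSkatoR p s₀ T (NSgevrey ε lam T s₀ v) ≤
          NSkatoC p s₀ T (fun t => heatHat 3 3 (ε * (t - s₀)) (v s₀)) +
            ENNReal.ofReal (Cε * Real.exp (lam ^ 2 / (4 * (1 - ε)))) *
              NSkatoR p s₀ T (NSgevrey ε lam T s₀ v) ^ 2)
    (t₀ : ℝ) (ht₀ : 0 ≤ t₀) (u : ℝ → Rd 3 → CN 3)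
    (humeas : ∀ j : Fin 3, Measurable fun q : ℝ × Rd 3 => u q.1 q.2 j)
    (hduh : ∀ T : ℝ, 0 < T → NSDuhamelIneq C₀ t₀ T u)
    (A : ℝ) (hA : 0 < A) (hHhalf : hSob 3 3 (1/2) (u t₀) = ENNReal.ofReal A)
    (hreg : ∀ lam : ℝ, 0 < lam →
      (∀ T : ℝ, 0 < T → NSkatoR p t₀ T (NSgevrey ε lam T t₀ u) < ⊤) ∧
      ContinuousOn (fun T => NSkatoR p t₀ T (NSgevrey ε lam T t₀ u)) (Set.Ioi (0:ℝ)) ∧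
      Filter.Tendsto (fun T => NSkatoR p t₀ T (NSgevrey ε lam T t₀ u))
        (𝓝[>] (0:ℝ)) (𝓝 0))
    (hsmall : A ≤ 1 / (4 * Cε) / (2 * Kε)) (T : ℝ) (hT : 0 < T) :
      ENNReal.ofReal (T ^ (1 / p)) *
          hSobR 3 (1/2 + 2 / p)
            (fun ξ => Real.exp ((2 * Real.sqrt (1 - ε) *
                Real.sqrt (Real.log (1 / (4 * Cε) / (2 * Kε * A)))) *
              Real.sqrt T * ‖ξ‖) * ‖u (t₀ + T) ξ‖) ≤
        ENNReal.ofReal (1 / (4 * Cε)) := by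
  have hε1 : 0 < 1 - ε := by linarith [hε.2]
  have hb : ∀ lam : ℝ, 0 < lam → Real.exp (lam ^ 2 / (4 * (1 - ε))) * (4 * Cε * Kε * A) < 1 →
      ∀ T : ℝ, 0 < T → NSkatoR p t₀ T (NSgevrey ε lam T t₀ u) ≤ ENNReal.ofReal (2 * Kε * A) := by
    intro lam hlam hL T hT
    by_contra hcon
    push Not at hcon
    obtain ⟨-, hcont, hlim⟩ := hreg lam hlam
    have hy : 0 < 2 * Kε * A := by positivity
    have hev := hlim.eventually (gt_mem_nhds (ENNReal.ofReal_pos.mpr hy))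
    obtain ⟨T', hT', hT'0⟩ := (hev.and self_mem_nhdsWithin).exists
    obtain ⟨T₂, hT₂, hxT⟩ := isPreconnected_Ioi.intermediate_value hT'0 (Set.mem_Ioi.mpr hT) hcont
      (show ENNReal.ofReal (2 * Kε * A) ∈ Set.Icc _ _ from ⟨hT'.le, hcon.le⟩)
    have hk := hkey lam T₂ t₀ hlam hT₂ ht₀ u humeas (hduh T₂ hT₂)
    simp only at hxT
    rw [hxT] at hk
    have hC : NSkatoC p t₀ T₂ (fun t => heatHat 3 3 (ε * (t - t₀)) (u t₀)) ≤
        ENNReal.ofReal (Kε * A) := by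
      unfold NSkatoC
      refine iSup₂_le fun t ht => ?_
      refine (hKprop (u t₀) (t - t₀) (sub_pos.mpr ht.1)).trans (le_of_eq ?_)
      rw [hHhalf, ENNReal.ofReal_mul hKε.le]
    have hk2 := hk.trans (add_le_add hC le_rfl)
    rw [← ENNReal.ofReal_pow hy.le, ← ENNReal.ofReal_mul (by positivity),
      ← ENNReal.ofReal_add (by positivity) (by positivity),
      ENNReal.ofReal_le_ofReal_iff (by positivity)] at hk2
    have : Cε * Real.exp (lam ^ 2 / (4 * (1 - ε))) * (2 * Kε * A) ^ 2 =
      (Real.exp (lam ^ 2 / (4 * (1 - ε))) * (4 * Cε * Kε * A)) * (Kε * A) := by ring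
    rw [this] at hk2
    have hKA : 0 < Kε * A := by positivity
    nlinarith
  have hb2 : ∀ lam : ℝ, 0 < lam →
      Real.exp (lam ^ 2 / (4 * (1 - ε))) * (4 * Cε * Kε * A) < 1 →
      ENNReal.ofReal (T ^ (1 / p)) * hSobR 3 (1/2 + 2 / p)
        (fun ξ => Real.exp (lam * Real.sqrt T * ‖ξ‖) * ‖u (t₀ + T) ξ‖) ≤
      ENNReal.ofReal (Real.exp (lam ^ 2 / (4 * (1 - ε))) * (2 * Kε * A)) := by
    intro lam hlam hL
    have h1 := hb lam hlam hL T hT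
    have h2 : ENNReal.ofReal (T ^ (1 / p)) *
        hSobR 3 (1/2 + 2 / p) (NSgevrey ε lam T t₀ u (t₀ + T)) ≤ ENNReal.ofReal (2 * Kε * A) := by
      refine le_trans ?_ h1
      unfold NSkatoR
      have := le_iSup₂ (f := fun t (_ : t ∈ Set.Ioc t₀ (t₀ + T)) =>
        ENNReal.ofReal ((t - t₀) ^ (1 / p)) *
          hSobR 3 (1/2 + 2 / p) (NSgevrey ε lam T t₀ u t)) (t₀ + T) ⟨by linarith, le_rfl⟩
      simpa using this
    have h3 : (fun ξ => Real.exp (lam * Real.sqrt T * ‖ξ‖) * ‖u (t₀ + T) ξ‖) =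
        fun ξ => Real.exp (lam ^ 2 / (4 * (1 - ε))) * NSgevrey ε lam T t₀ u (t₀ + T) ξ := by
      funext ξ
      unfold NSgevrey
      rw [← mul_assoc, ← Real.exp_add]
      congr 2
      have hsT : 0 < Real.sqrt T := Real.sqrt_pos.mpr hT
      have e1 : t₀ + T - t₀ = T := by ring
      have e2 : lam * T * ‖ξ‖ / Real.sqrt T = lam * Real.sqrt T * ‖ξ‖ := by
        rw [div_eq_iff hsT.ne']
        nth_rewrite 1 [← Real.mul_self_sqrt hT.le]
        ring
      rw [e1, e2]
      field_simp
      ring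
    rw [h3, aux_hSobR_mul _ _ (Real.exp_pos _).le, ENNReal.ofReal_mul (Real.exp_pos _).le,
      mul_left_comm]
    exact mul_le_mul_right h2 _
  set E := 1 / (4 * Cε) / (2 * Kε * A) with hE
  have hE1 : 1 ≤ E := by
    rw [hE, le_div_iff₀ (by positivity)]
    rw [le_div_iff₀ (by positivity)] at hsmall
    linarith
  have hE0 : 0 < E := by linarith
  set l₀ := 2 * Real.sqrt (1 - ε) * Real.sqrt (Real.log E) with hl₀
  have hl0 : 0 ≤ l₀ := by positivity
  have hexp : Real.exp (l₀ ^ 2 / (4 * (1 - ε))) = E := by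
    have : l₀ ^ 2 / (4 * (1 - ε)) = Real.log E := by
      rw [hl₀, mul_pow, mul_pow, Real.sq_sqrt hε1.le, Real.sq_sqrt (Real.log_nonneg hE1)]
      field_simp
      ring
    rw [this, Real.exp_log hE0]
  have hcontE : Continuous fun l : ℝ => Real.exp (l ^ 2 / (4 * (1 - ε))) := by fun_prop
  have ht : Tendsto (fun l : ℝ => ENNReal.ofReal (Real.exp (l ^ 2 / (4 * (1 - ε))) * (2 * Kε * A)))
      (𝓝[>] l₀) (𝓝 (ENNReal.ofReal (1 / (4 * Cε)))) := by
    have : 1 / (4 * Cε) = Real.exp (l₀ ^ 2 / (4 * (1 - ε))) * (2 * Kε * A) := by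
      rw [hexp, hE]; field_simp
    rw [this]
    exact ((ENNReal.continuous_ofReal.comp (hcontE.mul continuous_const)).tendsto l₀).mono_left
      nhdsWithin_le_nhds
  refine ge_of_tendsto ht ?_
  have hev : ∀ᶠ l in 𝓝[>] l₀, Real.exp (l ^ 2 / (4 * (1 - ε))) * (4 * Cε * Kε * A) < 1 := by
    refine Filter.Eventually.filter_mono nhdsWithin_le_nhds ?_
    refine (hcontE.mul continuous_const).continuousAt.eventually_lt continuousAt_const ?_
    simp only [Pi.mul_apply]
    rw [hexp, hE]
    have : 1 / (4 * Cε) / (2 * Kε * A) * (4 * Cε * Kε * A) = 1 / 2 := by field_simp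
    rw [this]; norm_num
  filter_upwards [hev, self_mem_nhdsWithin] with l hl1 hl2
  have hl2' : l₀ < l := hl2
  refine le_trans ?_ (hb2 l (by linarith) hl1)
  refine mul_le_mul_right (aux_hSobR_mono _ _ _ (fun ξ => by positivity) fun ξ => ?_) _
  gcongr

lemma aux_norm_meas (u : ℝ → Rd 3 → CN 3)
    (humeas : ∀ j : Fin 3, Measurable fun q : ℝ × Rd 3 => u q.1 q.2 j) :
    Measurable fun q : ℝ × Rd 3 => ENNReal.ofReal ‖u q.1 q.2‖ := by
  refine ENNReal.measurable_ofReal.comp ?_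
  simp only [EuclideanSpace.norm_eq]
  refine Real.continuous_sqrt.measurable.comp ?_
  exact Finset.measurable_sum _ fun j _ => (humeas j).norm.pow_const 2

lemma aux_W_eq (s : ℝ) (f : Rd 3 → CN 3) :
    ∫⁻ x, auxW s (fun η => ENNReal.ofReal ‖f η‖) x ^ 2 = hSobR 3 s (fun ξ => ‖f ξ‖) ^ 2 := by
  unfold hSobR
  rw [← ENNReal.rpow_two, ← ENNReal.rpow_mul]
  rw [show (1 / 2 : ℝ) * 2 = 1 by norm_num, ENNReal.rpow_one]
  refine lintegral_congr fun x => ?_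
  unfold auxW
  rw [← ENNReal.ofReal_mul (by positivity), ← ENNReal.ofReal_pow (by positivity), mul_pow]
  congr 2
  rw [← Real.rpow_natCast, ← Real.rpow_mul (norm_nonneg _)]
  congr 1
  push_cast; ring

def auxG (u : ℝ → Rd 3 → CN 3) (t₀ T : ℝ) (ξ : Rd 3) : ℝ≥0∞ :=
  ∫⁻ t in Set.Ioc t₀ (t₀ + T), conv2E (fun η => ENNReal.ofReal ‖u t η‖)
    (fun η => ENNReal.ofReal ‖u t η‖) ξ

lemma aux_duh_pt (C₀ t₀ T : ℝ) (hT : 0 < T) (u : ℝ → Rd 3 → CN 3)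
    (hduh : NSDuhamelIneq C₀ t₀ T u) : ∀ ξ : Rd 3,
    ENNReal.ofReal ‖ξ‖ * ENNReal.ofReal ‖u (t₀ + T) ξ‖ ^ 2 ≤
      2 * (ENNReal.ofReal ‖ξ‖ * ENNReal.ofReal ‖u t₀ ξ‖ ^ 2) +
      2 * ENNReal.ofReal C₀ ^ 2 * (ENNReal.ofReal (‖ξ‖ ^ 3) * auxG u t₀ T ξ ^ 2) := by
  intro ξ
  have h1 := hduh (t₀ + T) ⟨by linarith, le_rfl⟩ ξ
  have h2 : ENNReal.ofReal ‖u (t₀ + T) ξ‖ ≤ ENNReal.ofReal ‖u t₀ ξ‖ +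
      ENNReal.ofReal C₀ * (ENNReal.ofReal ‖ξ‖ * auxG u t₀ T ξ) := by
    refine h1.trans (add_le_add ?_ (mul_le_mul_right ?_ _))
    · refine ENNReal.ofReal_le_ofReal (mul_le_of_le_one_left (norm_nonneg _) ?_)
      rw [Real.exp_le_one_iff]
      have : 0 ≤ (t₀ + T - t₀) * ‖ξ‖ ^ 2 := mul_nonneg (by linarith) (by positivity)
      linarith
    · unfold auxG
      rw [← lintegral_const_mul' _ _ ENNReal.ofReal_ne_top]
      refine setLIntegral_mono' measurableSet_Ioc fun t ht => ?_
      refine mul_le_mul_left (ENNReal.ofReal_le_ofReal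
        (mul_le_of_le_one_left (norm_nonneg _) ?_)) _
      rw [Real.exp_le_one_iff]
      have : 0 ≤ (t₀ + T - t) * ‖ξ‖ ^ 2 := mul_nonneg (by linarith [ht.2]) (by positivity)
      linarith
  have h3 := (pow_le_pow_left' h2 2).trans (aux_sq_add _ _)
  refine (mul_le_mul_right h3 _).trans (le_of_eq ?_)
  rw [ENNReal.ofReal_pow (norm_nonneg _)]
  ring

lemma aux_duh_low (s p t₀ T : ℝ) (hs : 0 < s) (hs3 : s < 3 / 2) (hp : 2 < p) (hT : 0 < T)
    (u : ℝ → Rd 3 → CN 3)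
    (humeas : ∀ j : Fin 3, Measurable fun q : ℝ × Rd 3 => u q.1 q.2 j)
    (c : ℝ≥0∞) (hc : c < ⊤)
    (hb : ∀ τ : ℝ, 0 < τ → ENNReal.ofReal (τ ^ (1 / p)) *
      hSobR 3 s (fun ξ => ‖u (t₀ + τ) ξ‖) ≤ c) :
    ∫⁻ ξ in Metric.closedBall (0 : Rd 3) 1,
      ENNReal.ofReal (‖ξ‖ ^ 3) * auxG u t₀ T ξ ^ 2 < ⊤ := by
  unfold auxG
  refine aux_low s p t₀ T hs hs3 hp hT (fun t η => ENNReal.ofReal ‖u t η‖)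
    (aux_norm_meas u humeas) (c ^ 2) (ENNReal.pow_lt_top hc) ?_
  intro t ht
  have hτ : 0 < t - t₀ := sub_pos.mpr ht.1
  have h1 := hb (t - t₀) hτ
  have e : t₀ + (t - t₀) = t := by ring
  rw [e] at h1
  rw [aux_W_eq]
  have e2 : ENNReal.ofReal ((t - t₀) ^ (-(2 / p))) =
      ENNReal.ofReal ((t - t₀) ^ (-(1 / p))) ^ 2 := by
    rw [← ENNReal.ofReal_pow (by positivity), ← Real.rpow_natCast, ← Real.rpow_mul hτ.le]
    congr 2
    push_cast; ring
  rw [e2, ← mul_pow]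
  refine pow_le_pow_left' ?_ 2
  have e3 : ENNReal.ofReal ((t - t₀) ^ (1 / p)) * ENNReal.ofReal ((t - t₀) ^ (-(1 / p))) = 1 := by
    rw [← ENNReal.ofReal_mul (by positivity), ← Real.rpow_add hτ]
    simp
  calc hSobR 3 s (fun ξ => ‖u t ξ‖) = ENNReal.ofReal ((t - t₀) ^ (1 / p)) *
        hSobR 3 s (fun ξ => ‖u t ξ‖) * ENNReal.ofReal ((t - t₀) ^ (-(1 / p))) := by
        rw [mul_right_comm, e3, one_mul]
    _ ≤ _ := mul_le_mul_left h1 _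

lemma aux_slice (F : ℝ → Rd 3 → ℝ≥0∞) (hF : Measurable fun q : ℝ × Rd 3 => F q.1 q.2) (t : ℝ) :
    Measurable (F t) := hF.comp (measurable_const.prodMk measurable_id)

lemma aux_F0 (u : ℝ → Rd 3 → CN 3)
    (humeas : ∀ j : Fin 3, Measurable fun q : ℝ × Rd 3 => u q.1 q.2 j) (t₀ : ℝ) :
    Measurable fun ξ : Rd 3 => ENNReal.ofReal ‖u t₀ ξ‖ :=
  aux_slice (fun t η => ENNReal.ofReal ‖u t η‖) (aux_norm_meas u humeas) t₀

lemma aux_init (v : Rd 3 → CN 3) (hHhalf : hSob 3 3 (1/2) v < ⊤) :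
    ∫⁻ ξ : Rd 3, ENNReal.ofReal ‖ξ‖ * ENNReal.ofReal ‖v ξ‖ ^ 2 < ⊤ := by
  unfold hSob at hHhalf
  have h12 : (0:ℝ) < 1 / 2 := by norm_num
  have h3 := (ENNReal.rpow_lt_top_iff_of_pos h12).mp hHhalf
  have e : ∀ ξ : Rd 3, ENNReal.ofReal ‖ξ‖ * ENNReal.ofReal ‖v ξ‖ ^ 2 =
      ENNReal.ofReal (‖ξ‖ ^ (2 * (1 / 2 : ℝ)) * ‖v ξ‖ ^ 2) := by
    intro ξ
    rw [← ENNReal.ofReal_pow (norm_nonneg _), ← ENNReal.ofReal_mul (norm_nonneg _),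
      show (2 * (1 / 2 : ℝ)) = 1 by norm_num, Real.rpow_one]
  simp only [e]
  exact h3

lemma aux_duh (s p C₀ t₀ T : ℝ) (hs : 0 < s) (hs3 : s < 3 / 2) (hp : 2 < p) (hT : 0 < T)
    (u : ℝ → Rd 3 → CN 3)
    (humeas : ∀ j : Fin 3, Measurable fun q : ℝ × Rd 3 => u q.1 q.2 j)
    (hduh : NSDuhamelIneq C₀ t₀ T u) (hHhalf : hSob 3 3 (1/2) (u t₀) < ⊤)
    (c : ℝ≥0∞) (hc : c < ⊤)
    (hb : ∀ τ : ℝ, 0 < τ → ENNReal.ofReal (τ ^ (1 / p)) *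
      hSobR 3 s (fun ξ => ‖u (t₀ + τ) ξ‖) ≤ c) :
    ∫⁻ ξ in Metric.closedBall (0 : Rd 3) 1,
      ENNReal.ofReal ‖ξ‖ * ENNReal.ofReal ‖u (t₀ + T) ξ‖ ^ 2 < ⊤ := by
  have hlow := aux_duh_low s p t₀ T hs hs3 hp hT u humeas c hc hb
  have hF0 := aux_F0 u humeas t₀
  have hinit := aux_init (u t₀) hHhalf
  have hpt := aux_duh_pt C₀ t₀ T hT u hduh
  have hn : Measurable fun ξ : Rd 3 => ENNReal.ofReal ‖ξ‖ := by fun_prop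
  have hm : Measurable fun ξ : Rd 3 => 2 * (ENNReal.ofReal ‖ξ‖ * ENNReal.ofReal ‖u t₀ ξ‖ ^ 2) :=
    (hn.mul (hF0.pow_const 2)).const_mul 2
  have h2 : (2 : ℝ≥0∞) ≠ ⊤ := ENNReal.ofNat_ne_top
  have hC2 : 2 * ENNReal.ofReal C₀ ^ 2 ≠ ⊤ :=
    ENNReal.mul_ne_top h2 (ENNReal.pow_ne_top ENNReal.ofReal_ne_top)
  have hle : ∫⁻ ξ in Metric.closedBall (0 : Rd 3) 1,
      ENNReal.ofReal ‖ξ‖ * ENNReal.ofReal ‖u (t₀ + T) ξ‖ ^ 2 ≤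
      2 * (∫⁻ ξ in Metric.closedBall (0 : Rd 3) 1,
        ENNReal.ofReal ‖ξ‖ * ENNReal.ofReal ‖u t₀ ξ‖ ^ 2) +
      2 * ENNReal.ofReal C₀ ^ 2 * ∫⁻ ξ in Metric.closedBall (0 : Rd 3) 1,
        ENNReal.ofReal (‖ξ‖ ^ 3) * auxG u t₀ T ξ ^ 2 := by
    rw [← lintegral_const_mul' _ _ h2, ← lintegral_const_mul' _ _ hC2, ← lintegral_add_left hm]
    exact lintegral_mono hpt
  refine lt_of_le_of_lt hle (ENNReal.add_lt_top.mpr ⟨ENNReal.mul_lt_top h2.lt_top ?_,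
    ENNReal.mul_lt_top hC2.lt_top hlow⟩)
  exact lt_of_le_of_lt (setLIntegral_le_lintegral _ _) hinit

/-- the main step in the proof of Corollary 1.4.  Let `ε ∈ (0,1)`,
`p ∈ (2,∞)`, `K_ε > 0` with `sup_{t>0} t^{1/p}‖e^{εtΔ}v‖_{Ḣ^{1/2+2/p}} ≤ K_ε ‖v‖_{Ḣ^{1/2}}`
for all `v`, and let `c_ε = 1/(4C_ε)` where `C_ε` is a constant for which the
Navier–Stokes key lemma (Statement 15) holds.  Let `u` be a mild solution of the 3D
Navier–Stokes equations on `[t₀,∞)` with `u(t₀) ∈ H^{1/2}(ℝ³)`, `u(t₀) ≠ 0`, with the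
stated regularity of the Gevrey Kato norms.  If `‖u(t₀)‖_{Ḣ^{1/2}} ≤ c_ε/(2K_ε)`, then for
every `T > 0`, with `λ_T = 2√(1−ε) log^{1/2}(c_ε/(2K_ε‖u(t₀)‖_{Ḣ^{1/2}}))`, one has
`T^{1/p}‖F⁻¹(e^{λ_T√T|ξ|}|û(t₀+T,ξ)|)‖_{Ḣ^{1/2+2/p}} ≤ c_ε`; in particular
`R(t₀+T) ≥ 2√(1−ε) √T log^{1/2}(c_ε/(2K_ε‖u(t₀)‖_{Ḣ^{1/2}}))` for every `T > 0`. -/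
theorem statement16 (ε p C₀ Kε Cε : ℝ) (hε : ε ∈ Set.Ioo (0:ℝ) 1) (hp : 2 < p)
    (hC₀ : 0 < C₀) (hKε : 0 < Kε) (hCε : 0 < Cε)
    -- the absorption property of the heat flow defining `K_ε`:
    (hKprop : ∀ v : Rd 3 → CN 3, ∀ t : ℝ, 0 < t →
      ENNReal.ofReal (t ^ (1 / p)) * hSob 3 3 (1/2 + 2 / p) (heatHat 3 3 (ε * t) v) ≤
        ENNReal.ofReal Kε * hSob 3 3 (1/2) v)
    -- `Cε` is a constant for which the Navier–Stokes key lemma (Statement 15) holds: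
    (hkey : ∀ lam T s₀ : ℝ, 0 < lam → 0 < T → 0 ≤ s₀ →
      ∀ v : ℝ → Rd 3 → CN 3,
        (∀ j : Fin 3, Measurable fun q : ℝ × Rd 3 => v q.1 q.2 j) →
        NSDuhamelIneq C₀ s₀ T v →
        NSkatoR p s₀ T (NSgevrey ε lam T s₀ v) ≤
          NSkatoC p s₀ T (fun t => heatHat 3 3 (ε * (t - s₀)) (v s₀)) +
            ENNReal.ofReal (Cε * Real.exp (lam ^ 2 / (4 * (1 - ε)))) *
              NSkatoR p s₀ T (NSgevrey ε lam T s₀ v) ^ 2)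
    (t₀ : ℝ) (ht₀ : 0 ≤ t₀) (u : ℝ → Rd 3 → CN 3)
    (humeas : ∀ j : Fin 3, Measurable fun q : ℝ × Rd 3 => u q.1 q.2 j)
    (hmild : IsNSMildFourier t₀ u)
    (hduh : ∀ T : ℝ, 0 < T → NSDuhamelIneq C₀ t₀ T u)
    (hL2 : hSob 3 3 0 (u t₀) < ⊤)
    (hHhalf : hSob 3 3 (1/2) (u t₀) < ⊤) (hne : hSob 3 3 (1/2) (u t₀) ≠ 0)
    (hreg : ∀ lam : ℝ, 0 < lam →
      (∀ T : ℝ, 0 < T → NSkatoR p t₀ T (NSgevrey ε lam T t₀ u) < ⊤) ∧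
      ContinuousOn (fun T => NSkatoR p t₀ T (NSgevrey ε lam T t₀ u)) (Set.Ioi (0:ℝ)) ∧
      Filter.Tendsto (fun T => NSkatoR p t₀ T (NSgevrey ε lam T t₀ u))
        (𝓝[>] (0:ℝ)) (𝓝 0))
    (hsmall : hSob 3 3 (1/2) (u t₀) ≤ ENNReal.ofReal (1 / (4 * Cε) / (2 * Kε))) :
    ∀ T : ℝ, 0 < T →
      (ENNReal.ofReal (T ^ (1 / p)) *
          hSobR 3 (1/2 + 2 / p)
            (fun ξ => Real.exp ((2 * Real.sqrt (1 - ε) *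
                Real.sqrt (Real.log (1 / (4 * Cε) /
                  (2 * Kε * (hSob 3 3 (1/2) (u t₀)).toReal)))) *
              Real.sqrt T * ‖ξ‖) * ‖u (t₀ + T) ξ‖) ≤
        ENNReal.ofReal (1 / (4 * Cε))) ∧
      ENNReal.ofReal (2 * Real.sqrt (1 - ε) * Real.sqrt T *
          Real.sqrt (Real.log (1 / (4 * Cε) /
            (2 * Kε * (hSob 3 3 (1/2) (u t₀)).toReal)))) ≤
        anaRadius 3 3 (1/2) (u (t₀ + T)) := by
  set A := (hSob 3 3 (1/2) (u t₀)).toReal with hAdef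
  have hA : 0 < A := ENNReal.toReal_pos hne hHhalf.ne
  have hAe : hSob 3 3 (1/2) (u t₀) = ENNReal.ofReal A := (ENNReal.ofReal_toReal hHhalf.ne).symm
  have hAs : A ≤ 1 / (4 * Cε) / (2 * Kε) := by
    rw [hAe, ENNReal.ofReal_le_ofReal_iff (by positivity)] at hsmall
    exact hsmall
  have hfirst := aux_first ε p C₀ Kε Cε hε hKε hCε hKprop hkey t₀ ht₀ u humeas hduh A hA hAe
    hreg hAs
  intro T hT
  refine ⟨hfirst T hT, ?_⟩
  set L := Real.sqrt (Real.log (1 / (4 * Cε) / (2 * Kε * A))) with hL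
  set ρ := 2 * Real.sqrt (1 - ε) * Real.sqrt T * L with hρ
  have hρ0 : 0 ≤ ρ := by positivity
  set s := 1 / 2 + 2 / p with hs
  have hp0 : 0 < p := by linarith
  have h2p : 0 < 2 / p := by positivity
  have h2p1 : 2 / p < 1 := by rw [div_lt_one hp0]; exact hp
  have hs0 : 0 < s := by rw [hs]; linarith
  have hs3 : s < 3 / 2 := by rw [hs]; linarith
  have hfin := aux_duh s p C₀ t₀ T hs0 hs3 hp hT u humeas (hduh T hT) hHhalf
    (ENNReal.ofReal (1 / (4 * Cε))) ENNReal.ofReal_lt_top (by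
      intro τ hτ
      refine le_trans (mul_le_mul_right (aux_hSobR_mono _ _ _ (fun ξ => norm_nonneg _)
        fun ξ => ?_) _) (hfirst τ hτ)
      refine le_mul_of_one_le_left (norm_nonneg _) (Real.one_le_exp ?_)
      positivity)
  unfold anaRadius
  refine le_iSup₂ (f := fun (ρ : ℝ) (_ : ρ ∈ {ρ : ℝ | 0 ≤ ρ ∧
      (∫⁻ ξ : Rd 3, ENNReal.ofReal (Real.exp (2 * ρ * ‖ξ‖) * ‖ξ‖ ^ (2 * (1 / 2 : ℝ)) *
        ‖u (t₀ + T) ξ‖ ^ 2)) < ⊤}) => ENNReal.ofReal ρ) ρ ⟨hρ0, ?_⟩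
  rw [← lintegral_add_compl _ (measurableSet_closedBall (x := (0 : Rd 3)) (ε := 1))]
  refine ENNReal.add_lt_top.mpr ⟨?_, ?_⟩
  · refine lt_of_le_of_lt (setLIntegral_mono' measurableSet_closedBall
      (g := fun ξ => ENNReal.ofReal (Real.exp (2 * ρ)) *
        (ENNReal.ofReal ‖ξ‖ * ENNReal.ofReal ‖u (t₀ + T) ξ‖ ^ 2)) fun ξ hξ => ?_) ?_
    · have h1 : ‖ξ‖ ≤ 1 := by simpa using hξ
      rw [← ENNReal.ofReal_pow (norm_nonneg _), ← ENNReal.ofReal_mul (norm_nonneg _),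
        ← ENNReal.ofReal_mul (Real.exp_pos _).le]
      refine ENNReal.ofReal_le_ofReal ?_
      have : (2 * (1 / 2 : ℝ)) = 1 := by norm_num
      rw [this, Real.rpow_one, mul_assoc]
      refine mul_le_mul_of_nonneg_right (Real.exp_le_exp.mpr ?_) (by positivity)
      nlinarith
    · rw [lintegral_const_mul' _ _ (by simp)]
      exact ENNReal.mul_lt_top ENNReal.ofReal_lt_top hfin
  · have h1 := hfirst T hT
    have h2 : hSobR 3 s (fun ξ => Real.exp ((2 * Real.sqrt (1 - ε) * L) *
              Real.sqrt T * ‖ξ‖) * ‖u (t₀ + T) ξ‖) < ⊤ := by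
      by_contra hcon
      rw [not_lt, top_le_iff] at hcon
      rw [hcon, ENNReal.mul_top (by simp; positivity)] at h1
      simp at h1
    unfold hSobR at h2
    have h3 := (ENNReal.rpow_lt_top_iff_of_pos (by norm_num)).mp h2
    refine lt_of_le_of_lt ?_ h3
    refine le_trans (setLIntegral_mono' measurableSet_closedBall.compl fun ξ hξ => ?_)
      (setLIntegral_le_lintegral _ _)
    have hx : 1 ≤ ‖ξ‖ := by
      simp at hξ
      exact hξ.le
    refine ENNReal.ofReal_le_ofReal ?_
    have e1 : (Real.exp ((2 * Real.sqrt (1 - ε) * L) * Real.sqrt T * ‖ξ‖)) ^ 2 =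
        Real.exp (2 * ρ * ‖ξ‖) := by
      rw [← Real.exp_nat_mul]
      congr 1
      rw [hρ]; push_cast; ring
    rw [mul_pow, e1, mul_comm (Real.exp _), mul_assoc]
    refine mul_le_mul_of_nonneg_right (Real.rpow_le_rpow_of_exponent_le hx ?_) (by positivity)
    rw [hs]; linarith

end
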